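/- There exists a constant c > 0 such that for every finite word i over I and all points a, b ∈ [0,1]², one has d(S_i(a), S_i(b)) ≥ c · d(a,b) · sup_{c₃ ∈ [0,1]²} α₂(D_{c₃} S_i), where d denotes the Euclidean metric on ℝ². -/

import Mathlib

open MeasureTheory Filter Set

noncomputable section

namespace FFL

/-- The unit square `[0,1]² ⊆ ℝ²`. -/
def sq : Set (ℝ × ℝ) := Set.Icc (0:ℝ) 1 ×ˢ Set.Icc (0:ℝ) 1

/-- The Euclidean metric on `ℝ²`. -/
def dE (a b : ℝ × ℝ) : ℝ := Real.sqrt ((a.1 - b.1) ^ 2 + (a.2 - b.2) ^ 2)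

/-- Squared Frobenius norm of a 2×2 real matrix. -/
def frobSq (A : Matrix (Fin 2) (Fin 2) ℝ) : ℝ := ∑ i, ∑ j, (A i j) ^ 2

/-- The larger singular value `α₁` of a 2×2 real matrix, i.e. the larger positive square
root of the eigenvalues of `AᵀA`, via the standard closed formula. -/
def sv1 (A : Matrix (Fin 2) (Fin 2) ℝ) : ℝ :=
  Real.sqrt ((frobSq A + Real.sqrt ((frobSq A) ^ 2 - 4 * (A.det) ^ 2)) / 2)

/-- The smaller singular value `α₂` of a 2×2 real matrix. -/
def sv2 (A : Matrix (Fin 2) (Fin 2) ℝ) : ℝ :=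
  Real.sqrt ((frobSq A - Real.sqrt ((frobSq A) ^ 2 - 4 * (A.det) ^ 2)) / 2)

/-- The nonlinear, non-conformal iterated function systems of Falconer, Fraser and Lee:
maps `S i (a₁,a₂) = (f i a₁, g i (a₁,a₂))` on the unit square, where `f i`, `g i` are
`C^{1+α}` contractions (with partial derivatives `fx`, `gx`, `gy`) satisfying the
domination condition. -/
structure System (I : Type) [Fintype I] where
  f : I → ℝ → ℝ
  g : I → ℝ × ℝ → ℝ
  fx : I → ℝ → ℝ
  gx : I → ℝ × ℝ → ℝ
  gy : I → ℝ × ℝ → ℝ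
  /-- the index set has at least two elements -/
  card2 : 2 ≤ Fintype.card I
  /-- each `S i` maps the unit square into itself -/
  mapsTo : ∀ i, Set.MapsTo (fun a => (f i a.1, g i a)) sq sq
  /-- `fx i` is the derivative of `f i` on `[0,1]` -/
  hasDeriv_f : ∀ i, ∀ x ∈ Set.Icc (0:ℝ) 1,
    HasDerivWithinAt (f i) (fx i x) (Set.Icc (0:ℝ) 1) x
  /-- `(gx i, gy i)` is the (total) derivative of `g i` on the unit square -/
  hasDeriv_g : ∀ i, ∀ a ∈ sq, HasFDerivWithinAt (g i)
      (gx i a • ContinuousLinearMap.fst ℝ ℝ ℝ + gy i a • ContinuousLinearMap.snd ℝ ℝ ℝ) sq a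
  /-- the derivatives are `α`-Hölder for some `α > 0`, i.e. `f i`, `g i` are `C^{1+α}` -/
  holder : ∃ α > (0:ℝ), ∃ H > (0:ℝ), ∀ i,
      (∀ x ∈ Set.Icc (0:ℝ) 1, ∀ y ∈ Set.Icc (0:ℝ) 1, |fx i x - fx i y| ≤ H * |x - y| ^ α) ∧
      (∀ a ∈ sq, ∀ b ∈ sq, |gx i a - gx i b| ≤ H * dE a b ^ α) ∧
      (∀ a ∈ sq, ∀ b ∈ sq, |gy i a - gy i b| ≤ H * dE a b ^ α)
  /-- the maps `f i`, `g i` (hence `S i`) are uniform contractions -/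
  contracting : ∃ c, 0 ≤ c ∧ c < 1 ∧ ∀ i,
      (∀ x ∈ Set.Icc (0:ℝ) 1, ∀ y ∈ Set.Icc (0:ℝ) 1, |f i x - f i y| ≤ c * |x - y|) ∧
      (∀ a ∈ sq, ∀ b ∈ sq, |g i a - g i b| ≤ c * dE a b) ∧
      (∀ a ∈ sq, ∀ b ∈ sq, dE (f i a.1, g i a) (f i b.1, g i b) ≤ c * dE a b)
  /-- the domination condition:
  `inf |f_{i,x}| > sup |g_{i,y}| ≥ inf |g_{i,y}| ≥ d > 0` -/
  domination : ∃ d > (0:ℝ), ∀ i,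
      d ≤ sInf ((fun a => |gy i a|) '' sq) ∧
      sSup ((fun a => |gy i a|) '' sq) < sInf ((fun x => |fx i x|) '' Set.Icc (0:ℝ) 1)

variable {I : Type} [Fintype I]

/-- The map `S i`. -/
def S (T : System I) (i : I) (a : ℝ × ℝ) : ℝ × ℝ := (T.f i a.1, T.g i a)

/-- The composition `S_w = S_{i₁} ∘ ⋯ ∘ S_{i_n}` along a finite word `w = (i₁,…,i_n)`. -/
def Sw (T : System I) : List I → ℝ × ℝ → ℝ × ℝ
  | [], a => a
  | i :: w, a => S T i (Sw T w a)

/-- The top-left entry `f_{w,x}(a)` of the (lower triangular) Jacobian `D_a S_w`,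
via the chain rule. -/
def fxw (T : System I) : List I → ℝ × ℝ → ℝ
  | [], _ => 1
  | i :: w, a => T.fx i (Sw T w a).1 * fxw T w a

/-- The bottom-right entry `g_{w,y}(a)` of the Jacobian `D_a S_w`. -/
def gyw (T : System I) : List I → ℝ × ℝ → ℝ
  | [], _ => 1
  | i :: w, a => T.gy i (Sw T w a) * gyw T w a

/-- The off-diagonal entry `g_{w,x}(a)` of the Jacobian `D_a S_w`. -/
def gxw (T : System I) : List I → ℝ × ℝ → ℝ
  | [], _ => 0
  | i :: w, a => T.gx i (Sw T w a) * fxw T w a + T.gy i (Sw T w a) * gxw T w a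

/-- The Jacobian matrix `D_a S_w`. -/
def Dmat (T : System I) (w : List I) (a : ℝ × ℝ) : Matrix (Fin 2) (Fin 2) ℝ :=
  !![fxw T w a, 0; gxw T w a, gyw T w a]

/-- The larger singular value `α₁(D_a S_w)`. -/
def alpha1 (T : System I) (w : List I) (a : ℝ × ℝ) : ℝ := sv1 (Dmat T w a)

/-- The smaller singular value `α₂(D_a S_w)`. -/
def alpha2 (T : System I) (w : List I) (a : ℝ × ℝ) : ℝ := sv2 (Dmat T w a)

/-- The restriction `i|n` of an infinite sequence to its first `n` symbols. -/
def word (ii : ℕ → I) (n : ℕ) : List I := List.ofFn (fun k : Fin n => ii k.1)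

/-- The iterated left shift `σⁿ`. -/
def shiftn (ii : ℕ → I) (n : ℕ) : ℕ → I := fun k => ii (k + n)

/-- The left shift `σ` on `Σ = I^ℕ`. -/
def shift (ii : ℕ → I) : ℕ → I := fun k => ii (k + 1)

/-- The cylinder set `[w] ⊆ Σ` of a finite word `w`. -/
def cyl (w : List I) : Set (ℕ → I) := {jj | ∀ k : Fin w.length, jj k.1 = w.get k}

/-- `F` is the attractor of the IFS: the (unique) nonempty compact subset of the unit
square with `F = ⋃ i, S i '' F`. -/
def IsAttractor (T : System I) (F : Set (ℝ × ℝ)) : Prop :=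
  F.Nonempty ∧ IsCompact F ∧ F ⊆ sq ∧ F = ⋃ i, S T i '' F

/-- The strong separation condition: the sets `S i '' F` are pairwise disjoint. -/
def SSC (T : System I) (F : Set (ℝ × ℝ)) : Prop :=
  ∀ i j : I, i ≠ j → Disjoint (S T i '' F) (S T j '' F)

/-- `Pi` is the canonical coding map `Π : Σ → [0,1]²`:
`Π(i)` is the unique point of `⋂ₙ S_{i|n}([0,1]²)`. -/
def IsCoding (T : System I) (Pi : (ℕ → I) → ℝ × ℝ) : Prop :=
  ∀ ii : ℕ → I, ∀ n : ℕ, Pi ii ∈ Sw T (word ii n) '' sq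

/-- `m` is quasi-Bernoulli with constant `L`:
`L⁻¹ m[w] m[v] ≤ m[wv] ≤ L m[w] m[v]` for all finite words `w, v`. -/
def QuasiBernoulli [MeasurableSpace I] (m : Measure (ℕ → I)) (L : ℝ) : Prop :=
  0 < L ∧ ∀ w v : List I,
    L⁻¹ * (m (cyl w)).toReal * (m (cyl v)).toReal ≤ (m (cyl (w ++ v))).toReal ∧
    (m (cyl (w ++ v))).toReal ≤ L * (m (cyl w)).toReal * (m (cyl v)).toReal

/-- The interval `Q₁(x,r) = [x - r/2, x + r/2]`. -/
def Q1 (x r : ℝ) : Set ℝ := Set.Icc (x - r / 2) (x + r / 2)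

/-- The square `Q₂(a,r) = (a₁ - r/2, a₁ + r/2) × (a₂ - r/2, a₂ + r/2)`. -/
def Q2 (a : ℝ × ℝ) (r : ℝ) : Set (ℝ × ℝ) :=
  Set.Ioo (a.1 - r / 2) (a.1 + r / 2) ×ˢ Set.Ioo (a.2 - r / 2) (a.2 + r / 2)

/-- The approximate square `B_n(a,r)`: points `b ∈ S_w([0,1]²)` with `|b₁ - a₁| ≤ r/2`. -/
def Bn (T : System I) (w : List I) (a : ℝ × ℝ) (r : ℝ) : Set (ℝ × ℝ) :=
  {b ∈ Sw T w '' sq | |b.1 - a.1| ≤ r / 2}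

/-- The closed Euclidean ball in `ℝ²`. -/
def ballE (x : ℝ × ℝ) (r : ℝ) : Set (ℝ × ℝ) := {y | dE x y ≤ r}

/-- A measure on `ℝ` is exact dimensional with dimension `s` if for a.e. `x`,
`log ν(B(x,r)) / log r → s` as `r → 0⁺`. -/
def ExactDim1 (ν : Measure ℝ) (s : ℝ) : Prop :=
  ∀ᵐ x ∂ν, Tendsto (fun r => Real.log (ν (Metric.closedBall x r)).toReal / Real.log r)
    (nhdsWithin 0 (Set.Ioi 0)) (nhds s)

/-- A measure on `ℝ²` is exact dimensional with dimension `s` (w.r.t. Euclidean balls). -/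
def ExactDim2 (ν : Measure (ℝ × ℝ)) (s : ℝ) : Prop :=
  ∀ᵐ x ∂ν, Tendsto (fun r => Real.log (ν (ballE x r)).toReal / Real.log r)
    (nhdsWithin 0 (Set.Ioi 0)) (nhds s)

/-- `η = sup_{i ∈ I, a, b ∈ [0,1]²} |g_{i,y}(a)| / |f_{i,x}(b)|`. -/
def eta (T : System I) : ℝ :=
  sSup {x : ℝ | ∃ i : I, ∃ a ∈ sq, ∃ b ∈ sq, x = |T.gy i a| / |T.fx i b.1|}

end FFL

open FFL

namespace FFL

lemma sv2_lowerTriangular_le (p q r : ℝ) : sv2 !![p, 0; q, r] ≤ |r| := by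
  have hF : frobSq !![p, 0; q, r] = p ^ 2 + q ^ 2 + r ^ 2 := by
    simp [frobSq, Fin.sum_univ_two]; ring
  have hD : (!![p, 0; q, r] : Matrix (Fin 2) (Fin 2) ℝ).det = p * r := by
    simp [Matrix.det_fin_two]
  rw [sv2, hF, hD, ← Real.sqrt_sq_eq_abs]
  apply Real.sqrt_le_sqrt
  have h : p ^ 2 + q ^ 2 - r ^ 2 ≤
      √((p ^ 2 + q ^ 2 + r ^ 2) ^ 2 - 4 * (p * r) ^ 2) := by
    apply Real.le_sqrt_of_sq_le
    nlinarith [sq_nonneg (q * r)]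
  linarith

lemma abs_fst_le_dE (a b : ℝ × ℝ) : |a.1 - b.1| ≤ dE a b :=
  Real.abs_le_sqrt (by nlinarith [sq_nonneg (a.2 - b.2)])

lemma abs_snd_le_dE (a b : ℝ × ℝ) : |a.2 - b.2| ≤ dE a b :=
  Real.abs_le_sqrt (by nlinarith [sq_nonneg (a.1 - b.1)])

lemma dE_nonneg (a b : ℝ × ℝ) : 0 ≤ dE a b := Real.sqrt_nonneg _

lemma dE_le_abs_add_abs (a b : ℝ × ℝ) : dE a b ≤ |a.1 - b.1| + |a.2 - b.2| := by
  apply Real.sqrt_le_iff.2 ⟨by positivity, ?_⟩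
  nlinarith [sq_abs (a.1 - b.1), sq_abs (a.2 - b.2), abs_nonneg (a.1 - b.1),
    abs_nonneg (a.2 - b.2), mul_nonneg (abs_nonneg (a.1 - b.1)) (abs_nonneg (a.2 - b.2))]

lemma dE_le_two {a b : ℝ × ℝ} (ha : a ∈ sq) (hb : b ∈ sq) : dE a b ≤ 2 := by
  obtain ⟨⟨h1, h2⟩, h3, h4⟩ := ha
  obtain ⟨⟨h5, h6⟩, h7, h8⟩ := hb
  have hx : |a.1 - b.1| ≤ 1 := abs_le.2 ⟨by linarith, by linarith⟩
  have hy : |a.2 - b.2| ≤ 1 := abs_le.2 ⟨by linarith, by linarith⟩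
  linarith [dE_le_abs_add_abs a b]

lemma convex_sq : Convex ℝ sq := (convex_Icc 0 1).prod (convex_Icc 0 1)

lemma zero_mem_sq : ((0, 0) : ℝ × ℝ) ∈ sq := by simp [sq]

lemma dE_segment_le {p q z c : ℝ × ℝ} {R : ℝ} (hz : z ∈ segment ℝ p q)
    (hp : dE p c ≤ R) (hq : dE q c ≤ R) : dE z c ≤ 2 * R := by
  obtain ⟨s, t, hs, ht, hst, rfl⟩ := hz
  have hp1 := abs_le.1 ((abs_fst_le_dE p c).trans hp)
  have hp2 := abs_le.1 ((abs_snd_le_dE p c).trans hp)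
  have hq1 := abs_le.1 ((abs_fst_le_dE q c).trans hq)
  have hq2 := abs_le.1 ((abs_snd_le_dE q c).trans hq)
  obtain rfl : s = 1 - t := by linarith
  have key : ∀ u v x : ℝ, (-R ≤ u - x ∧ u - x ≤ R) → (-R ≤ v - x ∧ v - x ≤ R) →
      |(1 - t) * u + t * v - x| ≤ R := by
    intro u v x hu hv
    rw [abs_le]
    constructor <;> nlinarith
  have h1 := key _ _ _ hp1 hq1
  have h2 := key _ _ _ hp2 hq2
  refine (dE_le_abs_add_abs _ _).trans ?_
  simp only [Prod.fst_add, Prod.snd_add, Prod.smul_fst, Prod.smul_snd, smul_eq_mul]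
  linarith

variable {I : Type} [Fintype I]

lemma Sw_mem_sq (T : System I) (w : List I) {a : ℝ × ℝ} (ha : a ∈ sq) : Sw T w a ∈ sq := by
  induction w with
  | nil => exact ha
  | cons i w ih => exact T.mapsTo i ih

lemma exists_f_sub_eq (T : System I) (i : I) {x y : ℝ} (hx : x ∈ Icc (0 : ℝ) 1)
    (hy : y ∈ Icc (0 : ℝ) 1) :
    ∃ z ∈ Icc (0 : ℝ) 1, T.f i x - T.f i y = T.fx i z * (x - y) := by
  obtain ⟨z, hz, h⟩ := domain_mvt
    (fun u hu => (T.hasDeriv_f i u hu).hasFDerivWithinAt) (convex_Icc 0 1) hy hx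
  refine ⟨z, (convex_Icc (0 : ℝ) 1).segment_subset hy hx hz, ?_⟩
  rw [h]
  simp [mul_comm]

lemma exists_g_sub_eq (T : System I) (i : I) {p q : ℝ × ℝ} (hp : p ∈ sq) (hq : q ∈ sq) :
    ∃ z ∈ segment ℝ p q,
      T.g i p - T.g i q = T.gx i z * (p.1 - q.1) + T.gy i z * (p.2 - q.2) := by
  obtain ⟨z, hz, h⟩ := domain_mvt (fun u hu => T.hasDeriv_g i u hu) convex_sq hq hp
  refine ⟨z, segment_symm ℝ q p ▸ hz, ?_⟩
  rw [h]
  simp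

lemma exists_bound_of_holder {h : ℝ × ℝ → ℝ} {H α : ℝ} (hH : 0 < H) (hα : 0 < α)
    (hh : ∀ a ∈ sq, ∀ b ∈ sq, |h a - h b| ≤ H * dE a b ^ α) :
    ∃ B, 0 ≤ B ∧ ∀ a ∈ sq, |h a| ≤ B := by
  refine ⟨|h (0, 0)| + H * 2 ^ α, by positivity, fun a ha => ?_⟩
  have h1 := hh a ha _ zero_mem_sq
  have h2 : dE a (0, 0) ^ α ≤ 2 ^ α :=
    Real.rpow_le_rpow (dE_nonneg _ _) (dE_le_two ha zero_mem_sq) hα.le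
  have h3 := abs_sub_abs_le_abs_sub (h a) (h (0, 0))
  nlinarith

/-- Uniform separation of `|g_{i,y}|` from `|f_{i,x}|`. -/
lemma exists_domination_bounds (T : System I) (i : I) :
    ∃ s m B : ℝ, 0 < s ∧ s < m ∧ 0 ≤ B ∧ (∀ a ∈ sq, |T.gy i a| ≤ s) ∧
      (∀ x ∈ Icc (0 : ℝ) 1, m ≤ |T.fx i x|) ∧ ∀ a ∈ sq, |T.gx i a| ≤ B := by
  obtain ⟨α, hα, H, hH, hol⟩ := T.holder
  obtain ⟨d, hd, dom⟩ := T.domination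
  obtain ⟨B, hB0, hB⟩ := exists_bound_of_holder hH hα (hol i).2.1
  obtain ⟨C, -, hC⟩ := exists_bound_of_holder hH hα (hol i).2.2
  have hs : ∀ a ∈ sq, |T.gy i a| ≤ sSup ((fun a => |T.gy i a|) '' sq) := fun a ha =>
    le_csSup ⟨C, by rintro _ ⟨b, hb, rfl⟩; exact hC b hb⟩ ⟨a, ha, rfl⟩
  have hi : d ≤ |T.gy i (0, 0)| := (dom i).1.trans
    (csInf_le ⟨0, by rintro _ ⟨b, hb, rfl⟩; exact abs_nonneg _⟩ ⟨_, zero_mem_sq, rfl⟩)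
  exact ⟨_, _, B, hd.trans_le (hi.trans (hs _ zero_mem_sq)), (dom i).2, hB0, hs, fun x hx =>
    csInf_le ⟨0, by rintro _ ⟨b, hb, rfl⟩; exact abs_nonneg _⟩ ⟨x, hx, rfl⟩, hB⟩

lemma dE_Sw_le (T : System I) {c : ℝ} (hc : 0 ≤ c)
    (hcon : ∀ i, ∀ a ∈ sq, ∀ b ∈ sq, dE (T.f i a.1, T.g i a) (T.f i b.1, T.g i b) ≤ c * dE a b)
    (w : List I) {a b : ℝ × ℝ} (ha : a ∈ sq) (hb : b ∈ sq) :
    dE (Sw T w a) (Sw T w b) ≤ 2 * c ^ w.length := by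
  induction w with
  | nil => simpa [Sw] using dE_le_two ha hb
  | cons i w ih =>
    refine (hcon i _ (Sw_mem_sq T w ha) _ (Sw_mem_sq T w hb)).trans ?_
    calc c * dE (Sw T w a) (Sw T w b) ≤ c * (2 * c ^ w.length) := by gcongr
      _ = _ := by rw [List.length_cons]; ring

/-- A geometrically decaying distortion bound for `g_{i,y}` along `S_w`. -/
lemma exists_gy_distortion (T : System I) :
    ∃ K ρ : ℝ, 0 ≤ K ∧ 0 ≤ ρ ∧ ρ < 1 ∧ ∀ (i : I) (w : List I), ∀ a ∈ sq, ∀ b ∈ sq, ∀ c ∈ sq,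
      ∀ z ∈ segment ℝ (Sw T w a) (Sw T w b),
        |T.gy i (Sw T w c)| ≤ |T.gy i z| * Real.exp (K * ρ ^ w.length) := by
  obtain ⟨α, hα, H, hH, hol⟩ := T.holder
  obtain ⟨d, hd, dom⟩ := T.domination
  obtain ⟨r, hr0, hr1, con⟩ := T.contracting
  refine ⟨H * 4 ^ α / d, r ^ α, by positivity, by positivity, Real.rpow_lt_one hr0 hr1 hα, ?_⟩
  intro i w a ha b hb c hc z hz
  have hcon := fun i => (con i).2.2
  have hzs : z ∈ sq := convex_sq.segment_subset (Sw_mem_sq T w ha) (Sw_mem_sq T w hb) hz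
  have hdist := dE_segment_le hz (dE_Sw_le T hr0 hcon w ha hc) (dE_Sw_le T hr0 hcon w hb hc)
  have hdz : d ≤ |T.gy i z| := (dom i).1.trans
    (csInf_le ⟨0, by rintro _ ⟨b, hb, rfl⟩; exact abs_nonneg _⟩ ⟨_, hzs, rfl⟩)
  have h1 := (hol i).2.2 z hzs _ (Sw_mem_sq T w hc)
  have h2 : dE z (Sw T w c) ^ α ≤ 4 ^ α * (r ^ α) ^ w.length := by
    calc dE z (Sw T w c) ^ α ≤ (4 * r ^ w.length) ^ α :=
          Real.rpow_le_rpow (dE_nonneg _ _) (by linarith) hα.le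
      _ = 4 ^ α * (r ^ α) ^ w.length := by
          rw [Real.mul_rpow (by norm_num) (by positivity), ← Real.rpow_natCast,
            ← Real.rpow_natCast, ← Real.rpow_mul hr0, ← Real.rpow_mul hr0, mul_comm α]
  have h3 := abs_sub_abs_le_abs_sub (T.gy i (Sw T w c)) (T.gy i z)
  rw [abs_sub_comm] at h3
  set u := H * 4 ^ α / d * (r ^ α) ^ w.length with hu
  have hu0 : 0 ≤ u := by positivity
  have hdu : d * u = H * (4 ^ α * (r ^ α) ^ w.length) := by rw [hu]; field_simp
  have h4 : |T.gy i (Sw T w c)| ≤ |T.gy i z| * (u + 1) := by nlinarith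
  exact h4.trans (by gcongr; exact Real.add_one_le_exp u)

lemma abs_gyw_mul_le (T : System I) (w : List I) {a b c : ℝ × ℝ} (ha : a ∈ sq) (hb : b ∈ sq)
    (hc : c ∈ sq) :
    |gyw T w c| * |a.1 - b.1| ≤ |(Sw T w a).1 - (Sw T w b).1| := by
  induction w with
  | nil => simp [gyw, Sw]
  | cons i w ih =>
    obtain ⟨s, m, -, -, hsm, -, hs, hm, -⟩ := exists_domination_bounds T i
    obtain ⟨z, hz, h⟩ := exists_f_sub_eq T i (Sw_mem_sq T w ha).1 (Sw_mem_sq T w hb).1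
    change |T.gy i (Sw T w c) * gyw T w c| * |a.1 - b.1| ≤
      |T.f i (Sw T w a).1 - T.f i (Sw T w b).1|
    rw [h, abs_mul, abs_mul, mul_assoc]
    exact mul_le_mul (((hs _ (Sw_mem_sq T w hc)).trans hsm.le).trans (hm z hz)) ih
      (by positivity) (abs_nonneg _)

/-- The vertical displacement of `S_w` is, up to a multiple of the horizontal displacement,
a factor comparable to `g_{w,y}` times the original vertical displacement. -/
lemma exists_vertical_factor (T : System I) :
    ∃ M C : ℝ, 0 ≤ M ∧ 0 < C ∧ ∀ (w : List I), ∀ a ∈ sq, ∀ b ∈ sq, ∃ P : ℝ,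
      |(Sw T w a).2 - (Sw T w b).2 - P * (a.2 - b.2)| ≤
        M * |(Sw T w a).1 - (Sw T w b).1| ∧
      ∀ c ∈ sq, |gyw T w c| ≤ |P| * C := by
  choose s m B hs0 hsm hB0 hs hm hB using exists_domination_bounds T
  obtain ⟨K, ρ, hK, hρ0, hρ1, hdis⟩ := exists_gy_distortion T
  have hq : ∀ i, 0 ≤ B i / (m i - s i) := fun i => div_nonneg (hB0 i) (sub_pos.2 (hsm i)).le
  set M := ∑ i, B i / (m i - s i) with hM
  have hM0 : 0 ≤ M := Finset.sum_nonneg fun i _ => hq i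
  have hMi : ∀ i, B i + s i * M ≤ m i * M := by
    intro i
    have h : B i / (m i - s i) ≤ M :=
      Finset.single_le_sum (f := fun i => B i / (m i - s i)) (fun i _ => hq i)
        (Finset.mem_univ i)
    rw [div_le_iff₀ (sub_pos.2 (hsm i))] at h
    linarith
  have main : ∀ (w : List I), ∀ a ∈ sq, ∀ b ∈ sq, ∃ P : ℝ,
      |(Sw T w a).2 - (Sw T w b).2 - P * (a.2 - b.2)| ≤
        M * |(Sw T w a).1 - (Sw T w b).1| ∧
      ∀ c ∈ sq, |gyw T w c| ≤
        |P| * Real.exp (K * ∑ k ∈ Finset.range w.length, ρ ^ k) := by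
    intro w a ha b hb
    induction w with
    | nil =>
      refine ⟨1, ?_, fun c _ => by simp [gyw]⟩
      simpa [Sw] using mul_nonneg hM0 (abs_nonneg (a.1 - b.1))
    | cons i w ih =>
      obtain ⟨P, hP, hPc⟩ := ih
      have hpa := Sw_mem_sq T w ha
      have hpb := Sw_mem_sq T w hb
      obtain ⟨x, hx, hf⟩ := exists_f_sub_eq T i hpa.1 hpb.1
      obtain ⟨z, hz, hg⟩ := exists_g_sub_eq T i hpa hpb
      have hzs : z ∈ sq := convex_sq.segment_subset hpa hpb hz
      refine ⟨T.gy i z * P, ?_, fun c hc => ?_⟩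
      · change |T.g i (Sw T w a) - T.g i (Sw T w b) - T.gy i z * P * (a.2 - b.2)| ≤
          M * |T.f i (Sw T w a).1 - T.f i (Sw T w b).1|
        rw [hf, hg, abs_mul]
        set X := (Sw T w a).1 - (Sw T w b).1
        set Y := (Sw T w a).2 - (Sw T w b).2
        calc |T.gx i z * X + T.gy i z * Y - T.gy i z * P * (a.2 - b.2)|
            = |T.gx i z * X + T.gy i z * (Y - P * (a.2 - b.2))| := by ring_nf
          _ ≤ |T.gx i z| * |X| + |T.gy i z| * |Y - P * (a.2 - b.2)| := by
            rw [← abs_mul, ← abs_mul]; exact abs_add_le _ _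
          _ ≤ B i * |X| + s i * (M * |X|) := by
            gcongr
            · exact hB i z hzs
            · exact (hs0 i).le
            · exact hs i z hzs
          _ = (B i + s i * M) * |X| := by ring
          _ ≤ (m i * M) * |X| := by gcongr; exact hMi i
          _ ≤ (|T.fx i x| * M) * |X| := by gcongr; exact hm i x hx
          _ = M * (|T.fx i x| * |X|) := by ring
      · change |T.gy i (Sw T w c) * gyw T w c| ≤ _
        rw [abs_mul, abs_mul, List.length_cons, Finset.sum_range_succ, mul_add, Real.exp_add]
        calc |T.gy i (Sw T w c)| * |gyw T w c|
            ≤ (|T.gy i z| * Real.exp (K * ρ ^ w.length)) *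
              (|P| * Real.exp (K * ∑ k ∈ Finset.range w.length, ρ ^ k)) :=
              mul_le_mul (hdis i w a ha b hb c hc z hz) (hPc c hc) (abs_nonneg _)
                (by positivity)
          _ = _ := by ring
  refine ⟨M, Real.exp (K * (1 - ρ)⁻¹), hM0, Real.exp_pos _, fun w a ha b hb => ?_⟩
  obtain ⟨P, h1, h2⟩ := main w a ha b hb
  refine ⟨P, h1, fun c hc => (h2 c hc).trans ?_⟩
  have hsum : ∑ k ∈ Finset.range w.length, ρ ^ k ≤ (1 - ρ)⁻¹ := by
    rw [← tsum_geometric_of_lt_one hρ0 hρ1]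
    exact (summable_geometric_of_lt_one hρ0 hρ1).sum_le_tsum _ fun k _ => pow_nonneg hρ0 k
  gcongr

end FFL

/-- lower bound on contraction of `S_w` in terms of the smaller singular
value. -/
theorem stmt13 {I : Type} [Fintype I] (T : System I) :
    ∃ c > (0:ℝ), ∀ (w : List I), ∀ a ∈ sq, ∀ b ∈ sq,
      c * dE a b * sSup ((fun c₃ => alpha2 T w c₃) '' sq) ≤ dE (Sw T w a) (Sw T w b) := by
  obtain ⟨M, C, hM, hC, hver⟩ := exists_vertical_factor T
  have hL : 0 < 1 + C * (1 + M) := by positivity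
  refine ⟨(1 + C * (1 + M))⁻¹, inv_pos.2 hL, fun w a ha b hb => ?_⟩
  obtain ⟨P, hP, hPc⟩ := hver w a ha b hb
  set D := dE (Sw T w a) (Sw T w b)
  have hX : |(Sw T w a).1 - (Sw T w b).1| ≤ D := abs_fst_le_dE _ _
  have hY : |(Sw T w a).2 - (Sw T w b).2| ≤ D := abs_snd_le_dE _ _
  have hPY : |P| * |a.2 - b.2| ≤ (1 + M) * D := by
    rw [← abs_mul]
    have h := abs_sub_abs_le_abs_sub (P * (a.2 - b.2)) ((Sw T w a).2 - (Sw T w b).2)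
    rw [abs_sub_comm (P * (a.2 - b.2))] at h
    nlinarith
  have key : ∀ c ∈ sq, dE a b * alpha2 T w c ≤ (1 + C * (1 + M)) * D := by
    intro c hc
    have h1 := abs_gyw_mul_le T w ha hb hc
    have h2 : |gyw T w c| * |a.2 - b.2| ≤ C * ((1 + M) * D) := by
      calc |gyw T w c| * |a.2 - b.2| ≤ |P| * C * |a.2 - b.2| := by gcongr; exact hPc c hc
        _ = C * (|P| * |a.2 - b.2|) := by ring
        _ ≤ C * ((1 + M) * D) := by gcongr
    calc dE a b * alpha2 T w c ≤ (|a.1 - b.1| + |a.2 - b.2|) * |gyw T w c| :=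
          mul_le_mul (dE_le_abs_add_abs a b) (sv2_lowerTriangular_le _ _ _)
            (Real.sqrt_nonneg _) (by positivity)
      _ ≤ (1 + C * (1 + M)) * D := by linarith
  rw [mul_assoc, inv_mul_le_iff₀ hL]
  rcases (dE_nonneg a b).eq_or_lt with h0 | h0
  · rw [← h0, zero_mul]
    exact mul_nonneg hL.le (dE_nonneg _ _)
  · rw [mul_comm, ← le_div_iff₀ h0]
    refine csSup_le (Set.Nonempty.image _ ⟨_, zero_mem_sq⟩) ?_
    rintro _ ⟨c, hc, rfl⟩
    rw [le_div_iff₀ h0, mul_comm]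
    exact key c hc
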